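/- arXiv:2305.03030 — 5 statements merged into one kernel-verified Lean document; each statement's English description precedes it below -/
import Mathlib

section
/- Let A, P be n×n real matrices with P symmetric positive definite and W := −(AᵀP + PA) positive definite. Then there exists λ > 0 (depending only on A and P) such that for every differentiable function x : ℝ → ℝⁿ satisfying x′(t) = A x(t) for all t, and all t₀ ≤ t₁, one has x(t₁)ᵀ P x(t₁) ≤ e^{−λ(t₁−t₀)} · x(t₀)ᵀ P x(t₀). -/
open Matrix

/-- A positive definite quadratic form dominates a positive multiple of any other one. -/
theorem Matrix.PosDef.exists_pos_mul_dotProduct_mulVec_le {ι : Type*} [Fintype ι]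
    {P W : Matrix ι ι ℝ} (hP : P.PosDef) (hW : W.PosDef) :
    ∃ c : ℝ, 0 < c ∧ ∀ v : ι → ℝ, c * (v ⬝ᵥ P *ᵥ v) ≤ v ⬝ᵥ W *ᵥ v := by
  have pos {M : Matrix ι ι ℝ} (hM : M.PosDef) {v : ι → ℝ} (hv : v ≠ 0) : 0 < v ⬝ᵥ M *ᵥ v := by
    simpa using hM.dotProduct_mulVec_pos hv
  have cont (M : Matrix ι ι ℝ) : Continuous fun v : ι → ℝ => v ⬝ᵥ M *ᵥ v :=
    continuous_id.dotProduct (continuous_const.matrix_mulVec continuous_id)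
  have ne {v : ι → ℝ} (hv : v ∈ Metric.sphere (0 : ι → ℝ) 1) : v ≠ 0 :=
    ne_zero_of_mem_unit_sphere ⟨v, hv⟩
  have unit {v : ι → ℝ} (hv : v ≠ 0) : ‖v‖⁻¹ • v ∈ Metric.sphere (0 : ι → ℝ) 1 := by
    simp [norm_smul, hv]
  obtain hS | hS := (Metric.sphere (0 : ι → ℝ) 1).eq_empty_or_nonempty
  · refine ⟨1, one_pos, fun v => ?_⟩
    obtain rfl : v = 0 := by
      by_contra hv
      exact hS.le (unit hv)
    simp
  · obtain ⟨u, hu, hmin⟩ := (isCompact_sphere (0 : ι → ℝ) 1).exists_isMinOn hS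
      (((cont W).continuousOn).div (cont P).continuousOn fun v hv => (pos hP (ne hv)).ne')
    refine ⟨_, div_pos (pos hW (ne hu)) (pos hP (ne hu)), fun v => ?_⟩
    by_cases hv : v = 0
    · simp [hv]
    have h := isMinOn_iff.1 hmin _ (unit hv)
    have hr : ‖v‖⁻¹ ≠ 0 := inv_ne_zero (norm_ne_zero_iff.2 hv)
    simp only [Pi.div_apply, mulVec_smul, dotProduct_smul, smul_dotProduct, smul_eq_mul,
      mul_div_mul_left _ _ hr] at h
    exact (le_div_iff₀ (pos hP hv)).1 h

theorem HasDerivAt.dotProduct_mulVec_self {ι : Type*} [Fintype ι] (P : Matrix ι ι ℝ)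
    {x : ℝ → ι → ℝ} {x' : ι → ℝ} {t : ℝ} (hx : HasDerivAt x x' t) :
    HasDerivAt (fun s => x s ⬝ᵥ P *ᵥ x s) (x' ⬝ᵥ P *ᵥ x t + x t ⬝ᵥ P *ᵥ x') t := by
  have hPx : HasDerivAt (fun s => P *ᵥ x s) (P *ᵥ x') t :=
    P.mulVecLin.toContinuousLinearMap.hasFDerivAt.comp_hasDerivAt t hx
  simp only [dotProduct, ← Finset.sum_add_distrib]
  exact HasDerivAt.fun_sum fun i _ => (hasDerivAt_pi.1 hx i).mul (hasDerivAt_pi.1 hPx i)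

/-- If `P` is symmetric positive definite and `W := -(AᵀP + PA)` is positive definite,
then there exists `λ > 0` (depending only on `A` and `P`) such that along every solution
of `ẋ = Ax` the Lyapunov function `xᵀPx` decays exponentially:
`x(t₁)ᵀPx(t₁) ≤ e^{-λ(t₁-t₀)} x(t₀)ᵀPx(t₀)` for all `t₀ ≤ t₁`. -/
theorem lyapunov_exponential_decay (n : ℕ) (A P : Matrix (Fin n) (Fin n) ℝ)
    (hP : P.PosDef) (hW : (-(Aᵀ * P + P * A)).PosDef) :
    ∃ lam : ℝ, 0 < lam ∧
      ∀ x : ℝ → (Fin n → ℝ),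
        (∀ t : ℝ, HasDerivAt x (A.mulVec (x t)) t) →
        ∀ t₀ t₁ : ℝ, t₀ ≤ t₁ →
          x t₁ ⬝ᵥ P.mulVec (x t₁) ≤
            Real.exp (-lam * (t₁ - t₀)) * (x t₀ ⬝ᵥ P.mulVec (x t₀)) := by
  obtain ⟨c, hc, hle⟩ := hP.exists_pos_mul_dotProduct_mulVec_le hW
  refine ⟨c, hc, fun x hx t₀ t₁ ht => ?_⟩
  have hexp (t : ℝ) : HasDerivAt (fun s => Real.exp (c * s)) (Real.exp (c * t) * c) t := by
    simpa using ((hasDerivAt_id t).const_mul c).exp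
  have hanti : Antitone fun t => Real.exp (c * t) * (x t ⬝ᵥ P *ᵥ x t) := by
    refine antitone_of_hasDerivAt_nonpos
      (fun t => (hexp t).mul ((hx t).dotProduct_mulVec_self P)) fun t => ?_
    have h := hle (x t)
    have hA : A *ᵥ x t ⬝ᵥ P *ᵥ x t = x t ⬝ᵥ (Aᵀ * P) *ᵥ x t := by
      rw [← mulVec_mulVec, dotProduct_mulVec (x t) Aᵀ, vecMul_transpose]
    rw [neg_mulVec, add_mulVec, dotProduct_neg, dotProduct_add, ← hA, ← mulVec_mulVec] at h
    rw [Pi.zero_apply, mul_assoc, ← mul_add]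
    exact mul_nonpos_of_nonneg_of_nonpos (Real.exp_pos _).le (by linarith)
  have h : Real.exp (c * t₁) * (x t₁ ⬝ᵥ P *ᵥ x t₁) ≤ Real.exp (c * t₀) * (x t₀ ⬝ᵥ P *ᵥ x t₀) :=
    hanti ht
  rw [show -c * (t₁ - t₀) = c * t₀ - c * t₁ by ring, Real.exp_sub, div_mul_eq_mul_div,
    le_div_iff₀' (Real.exp_pos _)]
  exact h
end

section
/- Let A ∈ ℝ^{n×n}, B ∈ ℝ^{n×p}, C ∈ ℝ^{m×n}, D ∈ ℝ^{m×p}, let Q ∈ ℝ^{m×m} be symmetric with −Q positive definite, R ∈ ℝ^{p×p} symmetric, S ∈ ℝ^{m×p}, and let P ∈ ℝ^{n×n} be symmetric positive definite. Suppose the symmetric block matrix [ −AᵀP − PA , −PB + CᵀS , Cᵀ ; −BᵀP + SᵀC , DᵀS + SᵀD + R , Dᵀ ; C , D , −Q⁻¹ ] is positive semidefinite. Then the system ẋ = Ax + Bu, y = Cx + Du is (Q,S,R)-dissipative from u to y with storage function V(x) = xᵀPx: for every continuous u : ℝ → ℝᵖ, every differentiable x : ℝ → ℝⁿ with x′(t)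 = A x(t) + B u(t) for all t, and setting y(t) := C x(t) + D u(t), for all t₀ ≤ t₁ one has x(t₁)ᵀPx(t₁) − x(t₀)ᵀPx(t₀) ≤ ∫_{t₀}^{t₁} ( y(t)ᵀQ y(t) + 2 y(t)ᵀ S u(t) + u(t)ᵀ R u(t) ) dt. -/
open Matrix intervalIntegral

/-- The symmetric 3×3 block matrix
`[ -AᵀP - PA , -PB + CᵀS , Cᵀ ; -BᵀP + SᵀC , DᵀS + SᵀD + R , Dᵀ ; C , D , -Q⁻¹ ]`
appearing in the `(Q,S,R)`-dissipativity LMI. -/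
noncomputable def dissipativityLMI {n p m : ℕ}
    (A : Matrix (Fin n) (Fin n) ℝ) (B : Matrix (Fin n) (Fin p) ℝ)
    (C : Matrix (Fin m) (Fin n) ℝ) (D : Matrix (Fin m) (Fin p) ℝ)
    (Q : Matrix (Fin m) (Fin m) ℝ) (S : Matrix (Fin m) (Fin p) ℝ)
    (R : Matrix (Fin p) (Fin p) ℝ) (P : Matrix (Fin n) (Fin n) ℝ) :
    Matrix (Fin n ⊕ Fin p ⊕ Fin m) (Fin n ⊕ Fin p ⊕ Fin m) ℝ :=
  Matrix.of fun i j =>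
    match i, j with
    | Sum.inl a, Sum.inl b => (-(Aᵀ * P) - P * A) a b
    | Sum.inl a, Sum.inr (Sum.inl b) => (-(P * B) + Cᵀ * S) a b
    | Sum.inl a, Sum.inr (Sum.inr b) => Cᵀ a b
    | Sum.inr (Sum.inl a), Sum.inl b => (-(Bᵀ * P) + Sᵀ * C) a b
    | Sum.inr (Sum.inl a), Sum.inr (Sum.inl b) => (Dᵀ * S + Sᵀ * D + R) a b
    | Sum.inr (Sum.inl a), Sum.inr (Sum.inr b) => Dᵀ a b
    | Sum.inr (Sum.inr a), Sum.inl b => C a b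
    | Sum.inr (Sum.inr a), Sum.inr (Sum.inl b) => D a b
    | Sum.inr (Sum.inr a), Sum.inr (Sum.inr b) => (-(Q⁻¹)) a b

namespace Matrix

/-- The quadratic form of the dissipativity LMI matrix at a vector split along its blocks. -/
lemma dotProduct_dissipativityLMI_mulVec {n p m : ℕ}
    (A : Matrix (Fin n) (Fin n) ℝ) (B : Matrix (Fin n) (Fin p) ℝ)
    (C : Matrix (Fin m) (Fin n) ℝ) (D : Matrix (Fin m) (Fin p) ℝ)
    (Q : Matrix (Fin m) (Fin m) ℝ) (S : Matrix (Fin m) (Fin p) ℝ)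
    (R : Matrix (Fin p) (Fin p) ℝ) (P : Matrix (Fin n) (Fin n) ℝ)
    (x : Fin n → ℝ) (u : Fin p → ℝ) (z : Fin m → ℝ) :
    Sum.elim x (Sum.elim u z) ⬝ᵥ
        dissipativityLMI A B C D Q S R P *ᵥ Sum.elim x (Sum.elim u z) =
      2 * ((C *ᵥ x + D *ᵥ u) ⬝ᵥ S *ᵥ u) + u ⬝ᵥ R *ᵥ u +
        2 * ((C *ᵥ x + D *ᵥ u) ⬝ᵥ z) - z ⬝ᵥ Q⁻¹ *ᵥ z -
        ((A *ᵥ x + B *ᵥ u) ⬝ᵥ P *ᵥ x + x ⬝ᵥ P *ᵥ (A *ᵥ x + B *ᵥ u)) := by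
  have hblocks : dissipativityLMI A B C D Q S R P =
      fromBlocks (-(Aᵀ * P) - P * A) (fromCols (-(P * B) + Cᵀ * S) Cᵀ)
        (fromRows (-(Bᵀ * P) + Sᵀ * C) C)
        (fromBlocks (Dᵀ * S + Sᵀ * D + R) Dᵀ D (-(Q⁻¹))) := by
    ext i j
    rcases i with i | i | i <;> rcases j with j | j | j <;> rfl
  have htr {k l : ℕ} (M : Matrix (Fin k) (Fin l) ℝ) (v : Fin l → ℝ) (w : Fin k → ℝ) :
      v ⬝ᵥ Mᵀ *ᵥ w = (M *ᵥ v) ⬝ᵥ w := by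
    rw [dotProduct_mulVec, vecMul_transpose]
  rw [hblocks]
  simp only [fromBlocks_mulVec, fromCols_mulVec, fromRows_mulVec, Sum.elim_comp_inl,
    Sum.elim_comp_inr, sumElim_dotProduct_sumElim, dotProduct_add, add_dotProduct,
    add_mulVec, sub_mulVec, neg_mulVec, dotProduct_neg, dotProduct_sub, mulVec_add,
    ← Sum.elim_add_add, ← mulVec_mulVec, htr]
  rw [dotProduct_comm (S *ᵥ u) (C *ᵥ x), dotProduct_comm (S *ᵥ u) (D *ᵥ u),
    dotProduct_comm z (C *ᵥ x), dotProduct_comm z (D *ᵥ u)]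
  ring

end Matrix

/-- The product rule for the dot product of two vector-valued functions. -/
lemma HasDerivAt.dotProduct {ι : Type*} [Fintype ι] {f g : ℝ → ι → ℝ} {f' g' : ι → ℝ} {t : ℝ}
    (hf : HasDerivAt f f' t) (hg : HasDerivAt g g' t) :
    HasDerivAt (fun s => f s ⬝ᵥ g s) (f' ⬝ᵥ g t + f t ⬝ᵥ g') t := by
  rw [hasDerivAt_pi] at hf hg
  have h := HasDerivAt.fun_sum (u := Finset.univ) fun i _ => (hf i).fun_mul (hg i)
  simpa only [_root_.dotProduct, Finset.sum_add_distrib] using h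

/-- Multiplication by a constant matrix commutes with differentiation. -/
lemma HasDerivAt.matrix_mulVec {ι κ : Type*} [Fintype ι] [Fintype κ] {f : ℝ → ι → ℝ}
    {f' : ι → ℝ} {t : ℝ} (M : Matrix κ ι ℝ) (hf : HasDerivAt f f' t) :
    HasDerivAt (fun s => M *ᵥ f s) (M *ᵥ f') t :=
  (LinearMap.toContinuousLinearMap M.mulVecLin).hasFDerivAt.comp_hasDerivAt t hf

/-- Feasibility of the dissipativity LMI bounds the derivative of the storage function
by the supply rate. -/
lemma storage_rate_le_supply_of_LMI {n p m : ℕ}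
    {A : Matrix (Fin n) (Fin n) ℝ} {B : Matrix (Fin n) (Fin p) ℝ}
    {C : Matrix (Fin m) (Fin n) ℝ} {D : Matrix (Fin m) (Fin p) ℝ}
    {Q : Matrix (Fin m) (Fin m) ℝ} {S : Matrix (Fin m) (Fin p) ℝ}
    {R : Matrix (Fin p) (Fin p) ℝ} {P : Matrix (Fin n) (Fin n) ℝ} (hQ : IsUnit Q)
    (hW : (dissipativityLMI A B C D Q S R P).PosSemidef) (x : Fin n → ℝ) (u : Fin p → ℝ) :
    (A *ᵥ x + B *ᵥ u) ⬝ᵥ P *ᵥ x + x ⬝ᵥ P *ᵥ (A *ᵥ x + B *ᵥ u) ≤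
      (C *ᵥ x + D *ᵥ u) ⬝ᵥ Q *ᵥ (C *ᵥ x + D *ᵥ u) +
        2 * ((C *ᵥ x + D *ᵥ u) ⬝ᵥ S *ᵥ u) + u ⬝ᵥ R *ᵥ u := by
  have h := hW.dotProduct_mulVec_nonneg
    (Sum.elim x (Sum.elim u (Q *ᵥ (C *ᵥ x + D *ᵥ u))))
  rw [star_trivial, dotProduct_dissipativityLMI_mulVec, mulVec_mulVec,
    nonsing_inv_mul Q ((isUnit_iff_isUnit_det Q).mp hQ), one_mulVec,
    dotProduct_comm (Q *ᵥ (C *ᵥ x + D *ᵥ u))] at h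
  linarith

/-- Feasibility of the `(Q,S,R)`-dissipativity LMI implies that `ẋ = Ax + Bu, y = Cx + Du`
is `(Q,S,R)`-dissipative from `u` to `y` with storage function `V(x) = xᵀPx`. -/
theorem dissipativity_of_LMI (n p m : ℕ)
    (A : Matrix (Fin n) (Fin n) ℝ) (B : Matrix (Fin n) (Fin p) ℝ)
    (C : Matrix (Fin m) (Fin n) ℝ) (D : Matrix (Fin m) (Fin p) ℝ)
    (Q : Matrix (Fin m) (Fin m) ℝ) (S : Matrix (Fin m) (Fin p) ℝ)
    (R : Matrix (Fin p) (Fin p) ℝ) (P : Matrix (Fin n) (Fin n) ℝ)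
    (hQ : Q.IsSymm) (hQneg : (-Q).PosDef) (hR : R.IsSymm) (hP : P.PosDef)
    (hW : (dissipativityLMI A B C D Q S R P).PosSemidef) :
    ∀ u : ℝ → (Fin p → ℝ), Continuous u →
    ∀ x : ℝ → (Fin n → ℝ),
      (∀ t : ℝ, HasDerivAt x (A.mulVec (x t) + B.mulVec (u t)) t) →
      ∀ t₀ t₁ : ℝ, t₀ ≤ t₁ →
        x t₁ ⬝ᵥ P.mulVec (x t₁) - x t₀ ⬝ᵥ P.mulVec (x t₀) ≤
          ∫ t in t₀..t₁,
            ((C.mulVec (x t) + D.mulVec (u t)) ⬝ᵥ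
                Q.mulVec (C.mulVec (x t) + D.mulVec (u t)) +
              2 * ((C.mulVec (x t) + D.mulVec (u t)) ⬝ᵥ S.mulVec (u t)) +
              u t ⬝ᵥ R.mulVec (u t)) := by
  intro u hu x hx t₀ t₁ ht
  have hxc : Continuous x := continuous_iff_continuousAt.mpr fun t => (hx t).continuousAt
  have hV (t : ℝ) := HasDerivAt.dotProduct (hx t) (HasDerivAt.matrix_mulVec P (hx t))
  have hQu : IsUnit Q := by simpa using hQneg.isUnit
  have hVint : IntervalIntegrable (fun t => (A *ᵥ x t + B *ᵥ u t) ⬝ᵥ P *ᵥ x t +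
      x t ⬝ᵥ P *ᵥ (A *ᵥ x t + B *ᵥ u t)) MeasureTheory.volume t₀ t₁ :=
    Continuous.intervalIntegrable (by fun_prop) _ _
  rw [← integral_eq_sub_of_hasDerivAt (fun t _ => hV t) hVint]
  exact integral_mono_on ht hVint (Continuous.intervalIntegrable (by fun_prop) _ _)
    fun t _ => storage_rate_le_supply_of_LMI hQu hW (x t) (u t)
end

section
/- Let A ∈ ℝ^{n×n}, B ∈ ℝ^{n×p}, C ∈ ℝ^{m×n}, D ∈ ℝ^{m×p}, Q ∈ ℝ^{m×m} symmetric with −Q positive definite, R ∈ ℝ^{p×p} symmetric, S ∈ ℝ^{m×p}, and P ∈ ℝ^{n×n} symmetric. Then the symmetric block matrix [ −AᵀP − PA , −PB + CᵀS , Cᵀ ; −BᵀP + SᵀC , DᵀS + SᵀD + R , Dᵀ ; C , D , −Q⁻¹ ] is positive semidefinite if and only if for all x ∈ ℝⁿ and u ∈ ℝᵖ, setting y := Cx + Du, the pointwise dissipation inequality 2 xᵀ P (Ax + Bu) ≤ yᵀQy + 2 yᵀS u + uᵀR u holds. -/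
open Matrix intervalIntegral

/-- The dissipativity LMI matrix as nested blocks. -/
lemma dissipativityLMI_eq_fromBlocks {n p m : ℕ}
    (A : Matrix (Fin n) (Fin n) ℝ) (B : Matrix (Fin n) (Fin p) ℝ)
    (C : Matrix (Fin m) (Fin n) ℝ) (D : Matrix (Fin m) (Fin p) ℝ)
    (Q : Matrix (Fin m) (Fin m) ℝ) (S : Matrix (Fin m) (Fin p) ℝ)
    (R : Matrix (Fin p) (Fin p) ℝ) (P : Matrix (Fin n) (Fin n) ℝ) :
    dissipativityLMI A B C D Q S R P =
      fromBlocks (-(Aᵀ * P) - P * A) (fromCols (-(P * B) + Cᵀ * S) Cᵀ)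
        (fromRows (-(Bᵀ * P) + Sᵀ * C) C)
        (fromBlocks (Dᵀ * S + Sᵀ * D + R) Dᵀ D (-(Q⁻¹))) := by
  ext (i | i | i) (j | j | j) <;> rfl

lemma isSymm_dissipativityLMI {n p m : ℕ}
    (A : Matrix (Fin n) (Fin n) ℝ) (B : Matrix (Fin n) (Fin p) ℝ)
    (C : Matrix (Fin m) (Fin n) ℝ) (D : Matrix (Fin m) (Fin p) ℝ)
    {Q : Matrix (Fin m) (Fin m) ℝ} (S : Matrix (Fin m) (Fin p) ℝ)
    {R : Matrix (Fin p) (Fin p) ℝ} {P : Matrix (Fin n) (Fin n) ℝ}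
    (hQ : Q.IsSymm) (hR : R.IsSymm) (hP : P.IsSymm) :
    (dissipativityLMI A B C D Q S R P).IsSymm := by
  rw [dissipativityLMI_eq_fromBlocks, IsSymm, fromBlocks_transpose, fromBlocks_transpose,
    transpose_fromRows, transpose_fromCols]
  simp only [transpose_add, transpose_sub, transpose_neg, transpose_mul, transpose_transpose,
    transpose_nonsing_inv, hQ.eq, hR.eq, hP.eq]
  congr 1
  · abel
  · congr 1
    abel

/-- A symmetric matrix defines a symmetric bilinear form. -/
lemma Matrix.IsSymm.dotProduct_mulVec_comm {ι α : Type*} [Fintype ι] [CommSemiring α]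
    {M : Matrix ι ι α} (hM : M.IsSymm) (v w : ι → α) : v ⬝ᵥ M *ᵥ w = w ⬝ᵥ M *ᵥ v := by
  rw [dotProduct_mulVec, ← mulVec_transpose, hM.eq, dotProduct_comm]

/-- The quadratic form of the dissipativity LMI, with its last argument written as `Q w`, after
completing the square in `w`. -/
lemma dotProduct_dissipativityLMI_mulVec {n p m : ℕ}
    (A : Matrix (Fin n) (Fin n) ℝ) (B : Matrix (Fin n) (Fin p) ℝ)
    (C : Matrix (Fin m) (Fin n) ℝ) (D : Matrix (Fin m) (Fin p) ℝ)
    {Q : Matrix (Fin m) (Fin m) ℝ} (S : Matrix (Fin m) (Fin p) ℝ)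
    (R : Matrix (Fin p) (Fin p) ℝ) {P : Matrix (Fin n) (Fin n) ℝ}
    (hQ : Q.IsSymm) (hQu : IsUnit Q.det) (hP : P.IsSymm)
    (x : Fin n → ℝ) (u : Fin p → ℝ) (w y : Fin m → ℝ) (hy : y = C *ᵥ x + D *ᵥ u) :
    Sum.elim x (Sum.elim u (Q *ᵥ w)) ⬝ᵥ
        (dissipativityLMI A B C D Q S R P *ᵥ Sum.elim x (Sum.elim u (Q *ᵥ w))) =
      y ⬝ᵥ Q *ᵥ y + 2 * (y ⬝ᵥ S *ᵥ u) + u ⬝ᵥ R *ᵥ u - 2 * (x ⬝ᵥ P *ᵥ (A *ᵥ x + B *ᵥ u)) +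
        (y - w) ⬝ᵥ (-Q) *ᵥ (y - w) := by
  have ht {k l : ℕ} (M : Matrix (Fin k) (Fin l) ℝ) (a : Fin l → ℝ) (b : Fin k → ℝ) :
      a ⬝ᵥ Mᵀ *ᵥ b = b ⬝ᵥ M *ᵥ a := by
    rw [mulVec_transpose, dotProduct_comm, dotProduct_mulVec]
  have hw : Q⁻¹ *ᵥ Q *ᵥ w = w := by
    rw [mulVec_mulVec, nonsing_inv_mul _ hQu, one_mulVec]
  have hCD : ∀ z : Fin m → ℝ, z ⬝ᵥ C *ᵥ x = z ⬝ᵥ y - z ⬝ᵥ D *ᵥ u := by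
    intro z
    rw [hy, dotProduct_add, add_sub_cancel_right]
  rw [dissipativityLMI_eq_fromBlocks, fromBlocks_mulVec]
  simp only [Sum.elim_comp_inl, Sum.elim_comp_inr, fromCols_mulVec, fromRows_mulVec,
    fromBlocks_mulVec, sumElim_dotProduct_sumElim, dotProduct_add, add_mulVec, sub_mulVec,
    neg_mulVec, dotProduct_sub, dotProduct_neg, sub_dotProduct, mulVec_add, mulVec_sub,
    ← mulVec_mulVec, ht, hw, hCD, ← Sum.elim_add_add]
  have hPx : ∀ a, P *ᵥ x ⬝ᵥ a = x ⬝ᵥ P *ᵥ a := fun a => by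
    rw [dotProduct_comm, hP.dotProduct_mulVec_comm]
  rw [hPx, hPx, dotProduct_comm (Q *ᵥ w) y, dotProduct_comm (Q *ᵥ w) w,
    dotProduct_comm (S *ᵥ u) y, dotProduct_comm (C *ᵥ x), hCD, dotProduct_comm (D *ᵥ u) (S *ᵥ u),
    dotProduct_comm (S *ᵥ u) y, hQ.dotProduct_mulVec_comm w y]
  ring

/-- The `(Q,S,R)`-dissipativity LMI is positive semidefinite iff the pointwise dissipation
inequality `2 xᵀP(Ax + Bu) ≤ yᵀQy + 2yᵀSu + uᵀRu` holds for all `x`, `u`,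
where `y := Cx + Du`. -/
theorem dissipativityLMI_iff_pointwise (n p m : ℕ)
    (A : Matrix (Fin n) (Fin n) ℝ) (B : Matrix (Fin n) (Fin p) ℝ)
    (C : Matrix (Fin m) (Fin n) ℝ) (D : Matrix (Fin m) (Fin p) ℝ)
    (Q : Matrix (Fin m) (Fin m) ℝ) (S : Matrix (Fin m) (Fin p) ℝ)
    (R : Matrix (Fin p) (Fin p) ℝ) (P : Matrix (Fin n) (Fin n) ℝ)
    (hQ : Q.IsSymm) (hQneg : (-Q).PosDef) (hR : R.IsSymm) (hP : P.IsSymm) :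
    (dissipativityLMI A B C D Q S R P).PosSemidef ↔
    ∀ (x : Fin n → ℝ) (u : Fin p → ℝ),
      2 * (x ⬝ᵥ P.mulVec (A.mulVec x + B.mulVec u)) ≤
        (C.mulVec x + D.mulVec u) ⬝ᵥ Q.mulVec (C.mulVec x + D.mulVec u) +
          2 * ((C.mulVec x + D.mulVec u) ⬝ᵥ S.mulVec u) +
          u ⬝ᵥ R.mulVec u := by
  have hQu : IsUnit Q.det := by
    have h := (isUnit_iff_isUnit_det _).mp hQneg.isUnit.neg
    rwa [neg_neg] at h
  have key := dotProduct_dissipativityLMI_mulVec A B C D S R hQ hQu hP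
  rw [posSemidef_iff_dotProduct_mulVec]
  constructor
  · rintro ⟨-, h⟩ x u
    have h₀ := h (Sum.elim x (Sum.elim u (Q *ᵥ (C *ᵥ x + D *ᵥ u))))
    rw [star_trivial, key x u _ _ rfl, sub_self, zero_dotProduct, add_zero] at h₀
    exact sub_nonneg.mp h₀
  · refine fun h => ⟨isSymm_dissipativityLMI A B C D S hQ hR hP, fun z => ?_⟩
    obtain ⟨x, u, v, rfl⟩ : ∃ x u v, z = Sum.elim x (Sum.elim u v) :=
      ⟨z ∘ Sum.inl, z ∘ Sum.inr ∘ Sum.inl, z ∘ Sum.inr ∘ Sum.inr, by ext (i | i | i) <;> rfl⟩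
    obtain ⟨w, rfl⟩ : ∃ w, v = Q *ᵥ w :=
      ⟨Q⁻¹ *ᵥ v, by rw [mulVec_mulVec, mul_nonsing_inv _ hQu, one_mulVec]⟩
    rw [star_trivial, key x u w _ rfl]
    exact add_nonneg (sub_nonneg.mpr (h x u)) (hQneg.posSemidef.dotProduct_mulVec_nonneg _)
end

section
/- Let P ∈ ℝ^{n×n} be symmetric positive definite, G ∈ ℝ^{n×n}, H ∈ ℝ^{n×p}, C ∈ ℝ^{m×n}, D ∈ ℝ^{m×p}, Q ∈ ℝ^{m×m} symmetric with −Q positive definite, R ∈ ℝ^{p×p} symmetric, and S ∈ ℝ^{m×p}. Suppose the symmetric block matrix [ −(G + Gᵀ) , −H + CᵀS , Cᵀ ; −Hᵀ + SᵀC , DᵀS + SᵀD + R , Dᵀ ; C , D , −Q⁻¹ ] is positive semidefinite. Then the system with A := P⁻¹G, B := P⁻¹H, i.e., ẋ = Ax + Bu, y = Cx + Du, is (Q,S,R)-dissipative from u to y with storage function V(x) = xᵀPx: for every continuous u : ℝ → ℝᵖ, every differentiable x : ℝ → ℝⁿ with x′(t) = A x(t) + B u(t) for all t, y(t) := C x(t)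 + D u(t), and all t₀ ≤ t₁: x(t₁)ᵀPx(t₁) − x(t₀)ᵀPx(t₀) ≤ ∫_{t₀}^{t₁} ( y(t)ᵀQ y(t) + 2 y(t)ᵀ S u(t) + u(t)ᵀ R u(t) ) dt. -/
open Matrix intervalIntegral

/-- The synthesized-topology dissipativity LMI
`[ -(G + Gᵀ) , -H + CᵀS , Cᵀ ; -Hᵀ + SᵀC , DᵀS + SᵀD + R , Dᵀ ; C , D , -Q⁻¹ ]`,
where `G = PA` and `H = PB` are the linearizing changes of variables. -/
noncomputable def synthesisLMI {n p m : ℕ}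
    (G : Matrix (Fin n) (Fin n) ℝ) (H : Matrix (Fin n) (Fin p) ℝ)
    (C : Matrix (Fin m) (Fin n) ℝ) (D : Matrix (Fin m) (Fin p) ℝ)
    (Q : Matrix (Fin m) (Fin m) ℝ) (S : Matrix (Fin m) (Fin p) ℝ)
    (R : Matrix (Fin p) (Fin p) ℝ) :
    Matrix (Fin n ⊕ Fin p ⊕ Fin m) (Fin n ⊕ Fin p ⊕ Fin m) ℝ :=
  Matrix.of fun i j =>
    match i, j with
    | Sum.inl a, Sum.inl b => (-(G + Gᵀ)) a b
    | Sum.inl a, Sum.inr (Sum.inl b) => (-H + Cᵀ * S) a b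
    | Sum.inl a, Sum.inr (Sum.inr b) => Cᵀ a b
    | Sum.inr (Sum.inl a), Sum.inl b => (-Hᵀ + Sᵀ * C) a b
    | Sum.inr (Sum.inl a), Sum.inr (Sum.inl b) => (Dᵀ * S + Sᵀ * D + R) a b
    | Sum.inr (Sum.inl a), Sum.inr (Sum.inr b) => Dᵀ a b
    | Sum.inr (Sum.inr a), Sum.inl b => C a b
    | Sum.inr (Sum.inr a), Sum.inr (Sum.inl b) => D a b
    | Sum.inr (Sum.inr a), Sum.inr (Sum.inr b) => (-(Q⁻¹)) a b

namespace Matrix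

variable {n p m : ℕ}

theorem dotProduct_synthesisLMI_mulVec
    (G : Matrix (Fin n) (Fin n) ℝ) (H : Matrix (Fin n) (Fin p) ℝ)
    (C : Matrix (Fin m) (Fin n) ℝ) (D : Matrix (Fin m) (Fin p) ℝ)
    (Q : Matrix (Fin m) (Fin m) ℝ) (S : Matrix (Fin m) (Fin p) ℝ)
    (R : Matrix (Fin p) (Fin p) ℝ) (x : Fin n → ℝ) (u : Fin p → ℝ) (z : Fin m → ℝ) :
    Sum.elim x (Sum.elim u z) ⬝ᵥ synthesisLMI G H C D Q S R *ᵥ Sum.elim x (Sum.elim u z) =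
      -(2 * (x ⬝ᵥ (G *ᵥ x + H *ᵥ u))) + 2 * ((C *ᵥ x + D *ᵥ u) ⬝ᵥ S *ᵥ u) + u ⬝ᵥ R *ᵥ u +
        2 * ((C *ᵥ x + D *ᵥ u) ⬝ᵥ z) - z ⬝ᵥ Q⁻¹ *ᵥ z := by
  have hblocks : synthesisLMI G H C D Q S R =
      fromBlocks (-(G + Gᵀ)) (fromCols (-H + Cᵀ * S) Cᵀ) (fromRows (-Hᵀ + Sᵀ * C) C)
        (fromBlocks (Dᵀ * S + Sᵀ * D + R) Dᵀ D (-Q⁻¹)) := by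
    ext (i | i | i) (j | j | j) <;> rfl
  have transpose_form {a b : ℕ} (M : Matrix (Fin a) (Fin b) ℝ) (v : Fin b → ℝ) (w : Fin a → ℝ) :
      v ⬝ᵥ Mᵀ *ᵥ w = (M *ᵥ v) ⬝ᵥ w := by
    rw [mulVec_transpose, dotProduct_comm, ← dotProduct_mulVec, dotProduct_comm]
  rw [hblocks]
  simp only [fromBlocks_mulVec, fromCols_mulVec, fromRows_mulVec, Sum.elim_comp_inl,
    Sum.elim_comp_inr, ← Sum.elim_add_add, sumElim_dotProduct_sumElim, add_mulVec, neg_mulVec,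
    ← mulVec_mulVec, dotProduct_add, add_dotProduct, dotProduct_neg, transpose_form]
  rw [dotProduct_comm (G *ᵥ x) x, dotProduct_comm (H *ᵥ u) x, dotProduct_comm (S *ᵥ u) (C *ᵥ x),
    dotProduct_comm (S *ᵥ u) (D *ᵥ u), dotProduct_comm z (C *ᵥ x), dotProduct_comm z (D *ᵥ u)]
  ring

/-- The pointwise dissipation inequality encoded by the synthesis LMI. -/
theorem PosSemidef.two_mul_dotProduct_le_supply
    {G : Matrix (Fin n) (Fin n) ℝ} {H : Matrix (Fin n) (Fin p) ℝ}
    {C : Matrix (Fin m) (Fin n) ℝ} {D : Matrix (Fin m) (Fin p) ℝ}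
    {Q : Matrix (Fin m) (Fin m) ℝ} {S : Matrix (Fin m) (Fin p) ℝ}
    {R : Matrix (Fin p) (Fin p) ℝ} (hW : (synthesisLMI G H C D Q S R).PosSemidef)
    (hQ : IsUnit Q) (x : Fin n → ℝ) (u : Fin p → ℝ) :
    2 * (x ⬝ᵥ (G *ᵥ x + H *ᵥ u)) ≤
      (C *ᵥ x + D *ᵥ u) ⬝ᵥ Q *ᵥ (C *ᵥ x + D *ᵥ u) + 2 * ((C *ᵥ x + D *ᵥ u) ⬝ᵥ S *ᵥ u) +
        u ⬝ᵥ R *ᵥ u := by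
  have h := hW.dotProduct_mulVec_nonneg
    (Sum.elim x (Sum.elim u (Q *ᵥ (C *ᵥ x + D *ᵥ u))))
  rw [star_trivial, dotProduct_synthesisLMI_mulVec, mulVec_mulVec _ Q⁻¹ Q,
    nonsing_inv_mul Q ((isUnit_iff_isUnit_det Q).mp hQ), one_mulVec,
    dotProduct_comm (Q *ᵥ (C *ᵥ x + D *ᵥ u))] at h
  linarith

theorem IsSymm.hasDerivAt_dotProduct_mulVec {P : Matrix (Fin n) (Fin n) ℝ} (hP : P.IsSymm)
    {x : ℝ → Fin n → ℝ} {x' : Fin n → ℝ} {t : ℝ} (hx : HasDerivAt x x' t) :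
    HasDerivAt (fun s => x s ⬝ᵥ P *ᵥ x s) (2 * (x t ⬝ᵥ P *ᵥ x')) t := by
  have hPx : HasDerivAt (fun s => P *ᵥ x s) (P *ᵥ x') t :=
    (LinearMap.toContinuousLinearMap P.mulVecLin).hasFDerivAt.comp_hasDerivAt t hx
  have hV : HasDerivAt (fun s => x s ⬝ᵥ P *ᵥ x s)
      (∑ i, (x' i * (P *ᵥ x t) i + x t i * (P *ᵥ x') i)) t :=
    HasDerivAt.fun_sum fun i _ => (hasDerivAt_pi.mp hx i).mul (hasDerivAt_pi.mp hPx i)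
  convert hV using 1
  rw [Finset.sum_add_distrib]
  change _ = x' ⬝ᵥ P *ᵥ x t + x t ⬝ᵥ P *ᵥ x'
  rw [dotProduct_mulVec x' P, ← mulVec_transpose, hP.eq, dotProduct_comm (P *ᵥ x')]
  ring

end Matrix

/-- Feasibility of the synthesized-topology dissipativity LMI implies that the system with
`A := P⁻¹G`, `B := P⁻¹H` is `(Q,S,R)`-dissipative from `u` to `y` with storage
`V(x) = xᵀPx`. -/
theorem dissipativity_of_synthesisLMI (n p m : ℕ)
    (P G : Matrix (Fin n) (Fin n) ℝ) (H : Matrix (Fin n) (Fin p) ℝ)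
    (C : Matrix (Fin m) (Fin n) ℝ) (D : Matrix (Fin m) (Fin p) ℝ)
    (Q : Matrix (Fin m) (Fin m) ℝ) (S : Matrix (Fin m) (Fin p) ℝ)
    (R : Matrix (Fin p) (Fin p) ℝ)
    (hP : P.PosDef) (hQ : Q.IsSymm) (hQneg : (-Q).PosDef) (hR : R.IsSymm)
    (hW : (synthesisLMI G H C D Q S R).PosSemidef) :
    ∀ u : ℝ → (Fin p → ℝ), Continuous u →
    ∀ x : ℝ → (Fin n → ℝ),
      (∀ t : ℝ, HasDerivAt x ((P⁻¹ * G).mulVec (x t) + (P⁻¹ * H).mulVec (u t)) t) →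
      ∀ t₀ t₁ : ℝ, t₀ ≤ t₁ →
        x t₁ ⬝ᵥ P.mulVec (x t₁) - x t₀ ⬝ᵥ P.mulVec (x t₀) ≤
          ∫ t in t₀..t₁,
            ((C.mulVec (x t) + D.mulVec (u t)) ⬝ᵥ
                Q.mulVec (C.mulVec (x t) + D.mulVec (u t)) +
              2 * ((C.mulVec (x t) + D.mulVec (u t)) ⬝ᵥ S.mulVec (u t)) +
              u t ⬝ᵥ R.mulVec (u t)) := by
  intro u hu x hx t₀ t₁ ht
  have hdet : IsUnit P.det := (isUnit_iff_isUnit_det P).mp hP.isUnit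
  have hQu : IsUnit Q := by simpa using hQneg.isUnit.neg
  have hPsymm : P.IsSymm := by simpa [IsHermitian, IsSymm] using hP.isHermitian
  have hxc : Continuous x := continuous_iff_continuousAt.mpr fun t => (hx t).continuousAt
  have hV (t : ℝ) : HasDerivAt (fun s => x s ⬝ᵥ P *ᵥ x s)
      (2 * (x t ⬝ᵥ (G *ᵥ x t + H *ᵥ u t))) t := by
    have h := hPsymm.hasDerivAt_dotProduct_mulVec (hx t)
    rwa [mulVec_add, mulVec_mulVec, mulVec_mulVec, mul_nonsing_inv_cancel_left _ _ hdet,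
      mul_nonsing_inv_cancel_left _ _ hdet] at h
  have hVc : Continuous fun t => 2 * (x t ⬝ᵥ (G *ᵥ x t + H *ᵥ u t)) := by fun_prop
  rw [← integral_eq_sub_of_hasDerivAt (fun t _ => hV t) (hVc.intervalIntegrable _ _)]
  refine integral_mono_on ht (hVc.intervalIntegrable _ _) (Continuous.intervalIntegrable ?_ _ _)
    fun t _ => hW.two_mul_dotProduct_le_supply hQu (x t) (u t)
  fun_prop
end

section
/- Consider N subsystems, where subsystem i has a differentiable state trajectory x_i : ℝ → ℝ^{n_i}, a continuous input u_i : ℝ → ℝ^{q_i} and a continuous output y_i : ℝ → ℝ^{q_i}, together with a storage value function V_i such that t ↦ V_i(x_i(t)) is differentiable and satisfies the differential dissipation inequality d/dt V_i(x_i(t)) ≤ Q_i‖y_i(t)‖² + 2 S_i ⟨y_i(t), u_i(t)⟩ + R_i‖u_i(t)‖² for all t, where Q_i, S_i, R_i ∈ ℝ are scalar dissipativity indices with R_i < 0. Let p_1,…,p_N > 0, define the block-diagonal matrices Q_p := diag(p_i Q_i I_{q_i}), S_p := diag(p_i S_i I_{q_i}), R_p := diag(p_i R_i I_{q_i}), and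 let M be an interconnection matrix (of compatible block dimensions) such that Q_p + S_p M + Mᵀ S_pᵀ + Mᵀ R_p M is negative semidefinite. If the subsystems are interconnected through u(t) = M y(t) (where u and y stack the u_i and y_i), then the total storage t ↦ Σ_{i=1}^{N} p_i V_i(x_i(t)) is nonincreasing on ℝ. -/
open Matrix

/-- The quadratic form of `A + B M + Mᵀ Bᵀ + Mᵀ C M`, with `A`, `B`, `C` diagonal, evaluated
coordinatewise. -/
theorem dotProduct_diagonal_interconnection_mulVec {ι : Type*} [Fintype ι] [DecidableEq ι]
    (a b c : ι → ℝ) (M : Matrix ι ι ℝ) (w : ι → ℝ) :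
    w ⬝ᵥ ((diagonal a + diagonal b * M + Mᵀ * (diagonal b)ᵀ + Mᵀ * diagonal c * M) *ᵥ w) =
      ∑ s, (a s * (w s * w s) + 2 * b s * (w s * (M *ᵥ w) s) +
        c s * ((M *ᵥ w) s * (M *ᵥ w) s)) := by
  have h (v : ι → ℝ) : w ⬝ᵥ (Mᵀ *ᵥ v) = (M *ᵥ w) ⬝ᵥ v := by
    rw [dotProduct_mulVec, vecMul_transpose]
  simp only [add_mulVec, ← mulVec_mulVec, dotProduct_add, h, diagonal_transpose]
  simp only [dotProduct, mulVec_diagonal, ← Finset.sum_add_distrib]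
  exact Finset.sum_congr rfl fun s _ => by ring

/-- Dissipativity-based interconnection topology synthesis: if each subsystem `i` satisfies
the differential dissipation inequality
`d/dt V_i(x_i(t)) ≤ Q_i‖y_i‖² + 2S_i⟨y_i,u_i⟩ + R_i‖u_i‖²` with `R_i < 0`, the scalars
`p_i > 0` and the interconnection matrix `M` are such that
`Q_p + S_p M + Mᵀ S_pᵀ + Mᵀ R_p M` is negative semidefinite (where
`Q_p = diag(p_i Q_i I)`, `S_p = diag(p_i S_i I)`, `R_p = diag(p_i R_i I)`), and the
subsystems are interconnected through `u = M y`, then the total storage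
`t ↦ Σ_i p_i V_i(x_i(t))` is nonincreasing on `ℝ`. -/
theorem totalStorage_antitone_of_interconnection (N : ℕ) (n q : Fin N → ℕ)
    (x : (i : Fin N) → ℝ → (Fin (n i) → ℝ))
    (u y : (i : Fin N) → ℝ → (Fin (q i) → ℝ))
    (V : (i : Fin N) → (Fin (n i) → ℝ) → ℝ)
    (V' : Fin N → ℝ → ℝ)
    (Qc Sc Rc p : Fin N → ℝ)
    (hx : ∀ i, Differentiable ℝ (x i))
    (hu : ∀ i, Continuous (u i)) (hy : ∀ i, Continuous (y i))
    (hR : ∀ i, Rc i < 0) (hp : ∀ i, 0 < p i)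
    (hV : ∀ i t, HasDerivAt (fun s => V i (x i s)) (V' i t) t)
    (hdiss : ∀ i t, V' i t ≤
      Qc i * (y i t ⬝ᵥ y i t) + 2 * Sc i * (y i t ⬝ᵥ u i t) + Rc i * (u i t ⬝ᵥ u i t))
    (M : Matrix ((i : Fin N) × Fin (q i)) ((i : Fin N) × Fin (q i)) ℝ)
    (hM : (-(Matrix.diagonal (fun s : (i : Fin N) × Fin (q i) => p s.1 * Qc s.1) +
        Matrix.diagonal (fun s : (i : Fin N) × Fin (q i) => p s.1 * Sc s.1) * M +
        Mᵀ * (Matrix.diagonal (fun s : (i : Fin N) × Fin (q i) => p s.1 * Sc s.1))ᵀ +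
        Mᵀ * Matrix.diagonal (fun s : (i : Fin N) × Fin (q i) => p s.1 * Rc s.1) * M)).PosSemidef)
    (hconn : ∀ t : ℝ,
      (fun s : (i : Fin N) × Fin (q i) => u s.1 t s.2) =
        M.mulVec (fun s : (i : Fin N) × Fin (q i) => y s.1 t s.2)) :
    Antitone (fun t : ℝ => ∑ i : Fin N, p i * V i (x i t)) := by
  have hderiv (t : ℝ) :
      HasDerivAt (fun t : ℝ => ∑ i, p i * V i (x i t)) (∑ i, p i * V' i t) t :=
    HasDerivAt.fun_sum fun i _ => (hV i t).const_mul (p i)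
  refine antitone_of_hasDerivAt_nonpos hderiv fun t => ?_
  have hquad := hM.dotProduct_mulVec_nonneg (fun s => y s.1 t s.2)
  rw [star_trivial, neg_mulVec, dotProduct_neg, dotProduct_diagonal_interconnection_mulVec,
    ← hconn t, Fintype.sum_sigma, neg_nonneg] at hquad
  refine (Finset.sum_le_sum fun i _ => ?_).trans hquad
  refine (mul_le_mul_of_nonneg_left (hdiss i t) (hp i).le).trans_eq ?_
  simp only [dotProduct, Finset.mul_sum, ← Finset.sum_add_distrib]
  exact Finset.sum_congr rfl fun j _ => by ring
end
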